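/- arXiv:math/9809055 — 2 statements merged into one kernel-verified Lean document; each statement's English description precedes it below -/
import Mathlib

section
/- Let G be a nontrivial finite group. Then either G contains a maximal proper subgroup that is normal in G, or G contains two distinct maximal proper subgroups whose intersection is a nontrivial subgroup. -/
namespace Subgroup

variable {G : Type*} [Group G]

/-- The nontrivial elements of `G` that are conjugate to an element of `M`. -/
def nontrivialConjugates (M : Subgroup G) : Set G :=
  {x | x ≠ 1 ∧ ∃ c : G, c⁻¹ * x * c ∈ M}

theorem mem_map_conj_iff (M : Subgroup G) (c x : G) :
    x ∈ M.map (MulAut.conj c).toMonoidHom ↔ c⁻¹ * x * c ∈ M :=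
  mem_map_equiv.trans (by rw [MulAut.conj_symm_apply])

theorem isCoatom_map_conj {M : Subgroup G} (hM : IsCoatom M) (c : G) :
    IsCoatom (M.map (MulAut.conj c).toMonoidHom) :=
  ((MulAut.conj c).mapSubgroup.isCoatom_iff M).2 hM

/-- A malnormal subgroup meets its distinct conjugates trivially, so its nontrivial conjugates
can be counted coset by coset. -/
theorem card_nontrivialConjugates (M : Subgroup G)
    (h : ∀ g x, x ≠ 1 → x ∈ M → g⁻¹ * x * g ∈ M → g ∈ M) :
    Nat.card M.nontrivialConjugates = M.index * Nat.card {x : M // x ≠ 1} := by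
  rw [index, ← Nat.card_prod]
  symm
  refine Nat.card_congr (Equiv.ofBijective (fun p ↦ ⟨p.1.out * p.2.1 * p.1.out⁻¹, ?_, p.1.out, ?_⟩)
    ⟨?_, ?_⟩)
  · rw [Ne, conj_eq_one_iff]
    simpa using p.2.2
  · simp [mul_assoc]
  · rintro ⟨q, ⟨x, hx⟩, hx1⟩ ⟨r, ⟨y, hy⟩, hy1⟩ heq
    have heq' : q.out * x * q.out⁻¹ = r.out * y * r.out⁻¹ := congrArg Subtype.val heq
    have hqr : q = r := by
      rw [← q.out_eq', ← r.out_eq']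
      refine QuotientGroup.eq.2 (h _ x (by simpa using hx1) hx ?_)
      have : (q.out⁻¹ * r.out)⁻¹ * x * (q.out⁻¹ * r.out) = y := by
        calc _ = r.out⁻¹ * (q.out * x * q.out⁻¹) * r.out := by group
          _ = y := by rw [heq']; group
      rwa [this]
    subst hqr
    have : x = y := by simpa using heq'
    subst this
    rfl
  · rintro ⟨x, hx1, c, hc⟩
    obtain ⟨m, hm⟩ := QuotientGroup.mk_out_eq_mul M c
    refine ⟨⟨(c : G ⧸ M), ⟨(m : G)⁻¹ * (c⁻¹ * x * c) * m,
      M.mul_mem (M.mul_mem (M.inv_mem m.2) hc) m.2⟩, ?_⟩, ?_⟩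
    · intro h1
      apply hx1
      have h2 : (m : G)⁻¹ * (c⁻¹ * x * c) * m = 1 := congrArg Subtype.val h1
      calc x = (c * m) * ((m : G)⁻¹ * (c⁻¹ * x * c) * m) * (c * m)⁻¹ := by group
        _ = 1 := by rw [h2]; group
    · apply Subtype.ext
      change (c : G ⧸ M).out * ((m : G)⁻¹ * (c⁻¹ * x * c) * m) * ((c : G ⧸ M).out)⁻¹ = x
      rw [hm]
      group

theorem card_nontrivialConjugates_add_index [Finite G] (M : Subgroup G)
    (h : ∀ g x, x ≠ 1 → x ∈ M → g⁻¹ * x * g ∈ M → g ∈ M) :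
    Nat.card M.nontrivialConjugates + M.index = Nat.card G := by
  classical
  have := Fintype.ofFinite M
  have h1 : Nat.card {x : M // x ≠ 1} + 1 = Nat.card M := by
    rw [Nat.card_eq_fintype_card, Nat.card_eq_fintype_card, Fintype.card_subtype_compl,
      Fintype.card_subtype_eq]
    exact Nat.sub_add_cancel Fintype.card_pos
  rw [card_nontrivialConjugates M h, ← M.index_mul_card, ← h1]
  ring

/-- A non-normal maximal subgroup that meets all other maximal subgroups trivially is
malnormal. -/
theorem mem_of_conj_mem_of_isCoatom {M : Subgroup G} (hM : IsCoatom M) (hn : ¬ M.Normal)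
    (hd : ∀ K : Subgroup G, IsCoatom K → M ≠ K → M ⊓ K = ⊥)
    (g x : G) (hx : x ≠ 1) (hxM : x ∈ M) (hgx : g⁻¹ * x * g ∈ M) : g ∈ M := by
  have heq : M = M.map (MulAut.conj g).toMonoidHom := by
    by_contra hne
    have hmem : x ∈ M ⊓ M.map (MulAut.conj g).toMonoidHom :=
      ⟨hxM, (mem_map_conj_iff M g x).2 hgx⟩
    rw [hd _ (isCoatom_map_conj hM g) hne] at hmem
    exact hx (mem_bot.1 hmem)
  have hN : normalizer (M : Set G) = M :=
    (hM.le_iff.1 le_normalizer).resolve_left fun ht ↦ hn (normalizer_eq_top_iff.1 ht)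
  rw [← hN, ← inv_mem_iff, mem_normalizer_iff]
  intro y
  rw [inv_inv, ← mem_map_conj_iff, ← heq]

end Subgroup

open Subgroup in
/-- **Proposition (maximal subgroups).** Let `G` be a nontrivial finite group. Then either `G`
contains a maximal proper subgroup that is normal in `G`, or `G` contains two distinct maximal
proper subgroups whose intersection is a nontrivial subgroup. Here a maximal proper subgroup is
a coatom in the lattice of subgroups. -/
theorem maximal_normal_or_two_maximal_intersect_nontrivially
    {G : Type*} [Group G] [Finite G] [Nontrivial G] :
    (∃ M : Subgroup G, IsCoatom M ∧ M.Normal) ∨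
    (∃ M₁ M₂ : Subgroup G, IsCoatom M₁ ∧ IsCoatom M₂ ∧ M₁ ≠ M₂ ∧ M₁ ⊓ M₂ ≠ ⊥) := by
  by_contra! hcon
  obtain ⟨hn, hd⟩ := hcon
  have hcard (M : Subgroup G) (hM : IsCoatom M) :
      Nat.card M.nontrivialConjugates + M.index = Nat.card G :=
    card_nontrivialConjugates_add_index M
      (mem_of_conj_mem_of_isCoatom hM (hn M hM) fun K hK ↦ hd M K hM hK)
  have hindex (M : Subgroup G) (hM : IsCoatom M) : 2 * M.index ≤ Nat.card G := by
    have hbot : M ≠ ⊥ := by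
      rintro rfl
      exact hn _ hM inferInstance
    rw [← M.index_mul_card, mul_comm]
    exact Nat.mul_le_mul_left _ (M.one_lt_card_iff_ne_bot.2 hbot)
  obtain ⟨M, hM, -⟩ := (eq_top_or_exists_le_coatom (⊥ : Subgroup G)).resolve_left bot_ne_top
  have hM2 : 1 < M.index := M.one_lt_index_of_ne_top hM.1
  obtain ⟨y, hy⟩ : ∃ y, y ∉ insert 1 M.nontrivialConjugates := by
    by_contra! hall
    have h1 := Set.ncard_insert_le (1 : G) M.nontrivialConjugates
    rw [Set.eq_univ_of_forall hall, Set.ncard_univ, ← Nat.card_coe_set_eq] at h1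
    have := hcard M hM
    omega
  rw [Set.mem_insert_iff, not_or] at hy
  have hzy : zpowers y ≠ ⊤ := fun ht ↦ by
    have : IsCyclic G := ⟨y, (eq_top_iff' _).1 ht⟩
    have := IsCyclic.isMulCommutative (α := G)
    exact hn M hM inferInstance
  obtain ⟨K, hK, hyK⟩ := (eq_top_or_exists_le_coatom (zpowers y)).resolve_left hzy
  rw [zpowers_le] at hyK
  have hdisj : Disjoint M.nontrivialConjugates K.nontrivialConjugates := by
    rw [Set.disjoint_left]
    rintro x ⟨hx, c, hc⟩ ⟨-, d, hd'⟩
    have heq : M.map (MulAut.conj (d⁻¹ * c)).toMonoidHom = K := by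
      by_contra hne
      have hmem : d⁻¹ * x * d ∈ M.map (MulAut.conj (d⁻¹ * c)).toMonoidHom ⊓ K := by
        refine ⟨(mem_map_conj_iff _ _ _).2 ?_, hd'⟩
        convert hc using 1
        group
      rw [hd _ _ (isCoatom_map_conj hM _) hK hne, mem_bot] at hmem
      apply hx
      calc x = d * (d⁻¹ * x * d) * d⁻¹ := by group
        _ = 1 := by rw [hmem]; group
    rw [← heq, mem_map_conj_iff] at hyK
    exact hy.2 ⟨hy.1, _, hyK⟩
  have hsub : M.nontrivialConjugates ∪ K.nontrivialConjugates ⊆ {1}ᶜ := by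
    rintro x (hx | hx)
    exacts [hx.1, hx.1]
  have hle := Set.ncard_le_ncard hsub
  have hone := Set.ncard_add_ncard_compl ({1} : Set G)
  rw [Set.ncard_union_eq hdisj, ← Nat.card_coe_set_eq, ← Nat.card_coe_set_eq] at hle
  rw [Set.ncard_singleton] at hone
  have := hcard M hM
  have := hcard K hK
  have := hindex M hM
  have := hindex K hK
  omega
end

section
/- Let p and q be distinct primes and let G be a nonabelian group of order p·q possessing a normal subgroup P of order p. Then the integral group cohomology of G with trivial coefficients ℤ is given by: H^0(G;ℤ) ≅ ℤ; H^i(G;ℤ) = 0 for all odd i; H^{2k}(G;ℤ) ≅ ℤ/qℤ for all k > 0 with k not divisible by q; and H^{2k}(G;ℤ) ≅ ℤ/(pq)ℤ for all k > 0 with k divisible by q. -/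
open CategoryTheory groupCohomology

universe u

section Acyclic

variable {k G : Type u} [CommRing k] [Group G]

theorem Rep.shortExact_of_exact {X : ShortComplex (Rep.{u} k G)}
    (hf : Function.Injective X.f.hom) (hg : Function.Surjective X.g.hom)
    (h : ∀ y, X.g.hom y = 0 → ∃ x, X.f.hom x = y) : X.ShortExact where
  exact := by
    apply (forget₂ (Rep k G) (ModuleCat k)).reflects_exact_of_faithful
    rw [ShortComplex.moduleCat_exact_iff]
    exact h
  mono_f := (Rep.mono_iff_injective _).2 hf
  epi_g := (Rep.epi_iff_surjective _).2 hg

theorem groupCohomology.exact_δ_map {X : ShortComplex (Rep k G)} (hX : X.ShortExact) (n : ℕ) :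
    Function.Exact (δ hX n (n + 1) rfl) (map (.id G) X.f (n + 1)) :=
  (ShortComplex.ShortExact.moduleCat_exact_iff_function_exact _).1 (mapShortComplex₁_exact hX rfl)

theorem groupCohomology.exact_map_map {X : ShortComplex (Rep k G)} (hX : X.ShortExact) (n : ℕ) :
    Function.Exact (map (.id G) X.f n) (map (.id G) X.g n) :=
  (ShortComplex.ShortExact.moduleCat_exact_iff_function_exact _).1 (mapShortComplex₂_exact hX n)

theorem groupCohomology.exact_map_δ {X : ShortComplex (Rep k G)} (hX : X.ShortExact) (n : ℕ) :
    Function.Exact (map (.id G) X.g n) (δ hX n (n + 1) rfl) :=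
  (ShortComplex.ShortExact.moduleCat_exact_iff_function_exact _).1 (mapShortComplex₃_exact hX rfl)

theorem groupCohomology.map_zero_injective {X : ShortComplex (Rep k G)} (hX : X.ShortExact) :
    Function.Injective (map (.id G) X.f 0) := by
  have := hX.mono_f
  exact (ModuleCat.mono_iff_injective _).1 inferInstance

/-- A trace `∑ g, g⁻¹ e g` factors through a coinduced module, so it is zero on cohomology in
positive degrees. -/
theorem groupCohomology.map_succ_eq_zero_of_trace [Fintype G] {A : Rep k G} (e : A.V →ₗ[k] A.V)
    (t : A ⟶ A)
    (ht : ∀ a, t.hom a = ∑ g : G, A.ρ g⁻¹ (e (A.ρ g a))) (n : ℕ) :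
    map (.id G) t (n + 1) = 0 := by
  let S : Subgroup G := ⊥
  let C : Rep k G := Rep.coind S.subtype (Rep.trivial k S A.V)
  let i : A ⟶ C := Rep.ofHom
    { toFun := fun a => ⟨fun g => e (A.ρ g a), fun s g => by
        obtain rfl := Subsingleton.elim s 1
        simp⟩
      map_add' := fun a b => by ext; simp
      map_smul' := fun a b => by ext; simp
      isIntertwining' := fun h => by
        ext a g
        change e (A.ρ g (A.ρ h a)) = e (A.ρ (g * h) a)
        simp }
  let r : C ⟶ A := Rep.ofHom
    { toFun := fun f => ∑ g : G, A.ρ g⁻¹ (f.1 g)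
      map_add' := fun a b => by simp [Finset.sum_add_distrib]
      map_smul' := fun a b => by simp [Finset.smul_sum]
      isIntertwining' := fun h => by
        ext f
        change ∑ g : G, A.ρ g⁻¹ (f.1 (g * h)) = A.ρ h (∑ g : G, A.ρ g⁻¹ (f.1 g))
        rw [map_sum]
        refine Fintype.sum_equiv (Equiv.mulRight h) _ _ fun g => ?_
        simp [← Module.End.mul_apply, ← map_mul] }
  have hir : t = i ≫ r := by
    ext a
    exact ht a
  have hC : Limits.IsZero (groupCohomology C (n + 1)) :=
    (isZero_groupCohomology_succ_of_subsingleton _ n).of_iso (coindIso _ _)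
  rw [hir, map_id_comp, hC.eq_of_tgt (map (.id G) i (n + 1)) 0, Limits.zero_comp]

instance groupCohomology.functor_additive (n : ℕ) : (functor k G n).Additive where
  map_add {A B f g} := by
    change HomologicalComplex.homologyMap ((cochainsFunctor k G).map (f + g)) n = _
    rw [Functor.map_add, HomologicalComplex.homologyMap_add]
    rfl

theorem groupCohomology.map_zero_eq_zero {A B : Rep k G} (f : A ⟶ B)
    (h : ∀ a ∈ A.ρ.invariants, f.hom a = 0) : map (.id G) f 0 = 0 := by
  rw [← cancel_mono (H0Iso B).hom, map_id_comp_H0Iso_hom, Limits.zero_comp]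
  have : (Rep.invariantsFunctor k G).map f = 0 := by
    ext a
    exact Subtype.ext (h a.1 a.2)
  rw [this, Limits.comp_zero]

theorem groupCohomology.bijective_δ {X : ShortComplex (Rep k G)} (hX : X.ShortExact) (n : ℕ)
    (h₁ : map (.id G) X.g n = 0) (h₂ : Limits.IsZero (groupCohomology X.X₂ (n + 1))) :
    Function.Bijective (δ hX n (n + 1) rfl) := by
  constructor
  · rw [injective_iff_map_eq_zero]
    intro a ha
    obtain ⟨b, rfl⟩ := (exact_map_δ hX n a).1 ha
    rw [h₁]; rfl
  · intro a
    refine (exact_δ_map hX n a).1 ?_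
    have := ModuleCat.subsingleton_of_isZero h₂
    exact Subsingleton.elim _ _

theorem groupCohomology.nonempty_equiv_map_zero {X : ShortComplex (Rep k G)} (hX : X.ShortExact)
    (h : map (.id G) X.g 0 = 0) :
    Nonempty (groupCohomology X.X₁ 0 ≃ₗ[k] groupCohomology X.X₂ 0) := by
  refine ⟨LinearEquiv.ofBijective (map (.id G) X.f 0).hom
    ⟨map_zero_injective hX, fun x => (exact_map_map hX 0 x).1 ?_⟩⟩
  rw [h]; rfl

theorem groupCohomology.nonempty_equiv_δ {X : ShortComplex (Rep k G)} (hX : X.ShortExact)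
    (h₁ : map (.id G) X.g 0 = 0) (h₂ : ∀ n, Limits.IsZero (groupCohomology X.X₂ (n + 1))) (n : ℕ) :
    Nonempty (groupCohomology X.X₁ (n + 1) ≃ₗ[k] groupCohomology X.X₃ n) := by
  have : map (.id G) X.g n = 0 := by
    cases n with
    | zero => exact h₁
    | succ n => exact (h₂ n).eq_of_src _ _
  exact ⟨(LinearEquiv.ofBijective (δ hX n (n + 1) rfl).hom (bijective_δ hX n this (h₂ n))).symm⟩

theorem Rep.exists_shortExact_of_exact {A B C E : Rep.{u} k G} (f : A ⟶ B) (d : B ⟶ C) (s : C ⟶ E)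
    (hf : Function.Injective f.hom) (hfd : Function.Exact f.hom d.hom)
    (hds : Function.Exact d.hom s.hom) (hs : Function.Surjective s.hom) :
    ∃ (W : Rep.{u} k G) (d' : B ⟶ W) (i : W ⟶ C) (w₁ : f ≫ d' = 0) (w₂ : i ≫ s = 0),
      d = d' ≫ i ∧ (ShortComplex.mk f d' w₁).ShortExact ∧ (ShortComplex.mk i s w₂).ShortExact := by
  have hW : ∀ g, LinearMap.ker s.hom.toLinearMap ≤
      (LinearMap.ker s.hom.toLinearMap).comap (C.ρ g) := by
    intro g x hx
    have hx : s.hom x = 0 := hx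
    change s.hom (C.ρ g x) = 0
    rw [Rep.hom_comm_apply, hx, map_zero]
  let W := Rep.subrepresentation C _ hW
  let i : W ⟶ C := Rep.subtype C _ hW
  let d' : B ⟶ W := Rep.ofHom
    { toLinearMap := d.hom.toLinearMap.codRestrict _ fun b => (hds _).2 ⟨b, rfl⟩
      isIntertwining' := fun g => by
        ext b
        exact Rep.hom_comm_apply d g b }
  have w₁ : f ≫ d' = 0 := by
    apply Rep.hom_ext
    ext a
    exact (hfd _).2 ⟨a, rfl⟩
  have w₂ : i ≫ s = 0 := by
    ext a
    exact a.2
  refine ⟨W, d', i, w₁, w₂, rfl, Rep.shortExact_of_exact hf ?_ ?_,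
    Rep.shortExact_of_exact Subtype.val_injective hs fun y hy => ⟨⟨y, hy⟩, rfl⟩⟩
  · rintro ⟨x, hx⟩
    obtain ⟨b, rfl⟩ := (hds x).1 hx
    exact ⟨b, rfl⟩
  · intro y hy
    exact (hfd y).1 (congrArg Subtype.val hy)

/-- Dimension shifting along a four-term exact sequence with acyclic middle terms. -/
theorem groupCohomology.nonempty_equiv_of_exact {A B C E : Rep k G}
    (f : A ⟶ B) (d : B ⟶ C) (s : C ⟶ E)
    (hf : Function.Injective f.hom) (hfd : Function.Exact f.hom d.hom)
    (hds : Function.Exact d.hom s.hom) (hs : Function.Surjective s.hom)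
    (hB : ∀ n, Limits.IsZero (groupCohomology B (n + 1)))
    (hC : ∀ n, Limits.IsZero (groupCohomology C (n + 1)))
    (hd₀ : map (.id G) d 0 = 0) (hs₀ : map (.id G) s 0 = 0) :
    Nonempty (groupCohomology A 0 ≃ₗ[k] groupCohomology B 0) ∧
    Nonempty (groupCohomology A 1 ≃ₗ[k] groupCohomology C 0) ∧
      ∀ n, Nonempty (groupCohomology A (n + 2) ≃ₗ[k] groupCohomology E n) := by
  obtain ⟨W, d', i, w₁, w₂, hdi, h₁, h₂⟩ := Rep.exists_shortExact_of_exact f d s hf hfd hds hs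
  have hd' : map (.id G) d' 0 = 0 := by
    have := h₂.mono_f
    have : Mono (map (.id G) i 0) := inferInstance
    rw [← cancel_mono (map (.id G) i 0), ← map_id_comp, ← hdi, hd₀, Limits.zero_comp]
  have b₁ := nonempty_equiv_δ h₁ hd' hB
  have b₂ := nonempty_equiv_δ h₂ hs₀ hC
  obtain ⟨b₀⟩ := nonempty_equiv_map_zero h₂ hs₀
  refine ⟨nonempty_equiv_map_zero h₁ hd', (b₁ 0).map fun b => b ≪≫ₗ b₀, fun n => ?_⟩
  obtain ⟨e₁⟩ := b₁ (n + 1)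
  obtain ⟨e₂⟩ := b₂ n
  exact ⟨e₁ ≪≫ₗ e₂⟩

theorem groupCohomology.map_nsmul_id (A : Rep k G) (m n : ℕ) (x : groupCohomology A n) :
    map (.id G) (B := A) (m • 𝟙 A) n x = m • x := by
  have h : map (.id G) (B := A) (m • 𝟙 A) n = m • 𝟙 _ := by
    rw [← map_id]
    exact (functor k G n).map_nsmul
  rw [h]
  rfl

theorem groupCohomology.card_nsmul_eq_zero [Finite G] (A : Rep k G) (n : ℕ)
    (x : groupCohomology A (n + 1)) : Nat.card G • x = 0 := by
  have := Fintype.ofFinite G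
  have h : map (.id G) (B := A) (Nat.card G • 𝟙 A) (n + 1) = 0 :=
    map_succ_eq_zero_of_trace (A := A) LinearMap.id _ (fun a => by
      have (g : G) : A.ρ g⁻¹ (A.ρ g a) = a := by
        rw [← Module.End.mul_apply, ← map_mul, inv_mul_cancel, map_one, Module.End.one_apply]
      change Nat.card G • a = _
      simp [this]) n
  rw [← map_nsmul_id, h]
  rfl

end Acyclic

section Difference

variable (ℓ : ℕ) [Fact ℓ.Prime]

/-- The logarithm of the translation by one on functions on `ZMod ℓ`, up to sign: on polynomials of
degree less than `ℓ` this is minus the derivative. -/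
noncomputable def ZMod.logDiff : (ZMod ℓ → ZMod ℓ) →ₗ[ZMod ℓ] (ZMod ℓ → ZMod ℓ) where
  toFun f t := ∑ u, u⁻¹ * (f (t + u) - f t)
  map_add' f g := by
    ext t
    simp only [Pi.add_apply, ← Finset.sum_add_distrib]
    exact Finset.sum_congr rfl fun u _ => by ring
  map_smul' a f := by
    ext t
    simp only [Pi.smul_apply, smul_eq_mul, Finset.mul_sum, RingHom.id_apply]
    exact Finset.sum_congr rfl fun u _ => by ring

/-- The sum of the values of a function on `ZMod ℓ`. -/
noncomputable def ZMod.sumAll : (ZMod ℓ → ZMod ℓ) →ₗ[ZMod ℓ] ZMod ℓ :=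
  ∑ t, LinearMap.proj t

variable {ℓ}

theorem ZMod.logDiff_apply (f : ZMod ℓ → ZMod ℓ) (t : ZMod ℓ) :
    ZMod.logDiff ℓ f t = ∑ u, u⁻¹ * (f (t + u) - f t) := rfl

theorem ZMod.sumAll_apply (f : ZMod ℓ → ZMod ℓ) : ZMod.sumAll ℓ f = ∑ t, f t := by
  simp [ZMod.sumAll]

theorem ZMod.eq_const_of_add_one {α : Type*} {f : ZMod ℓ → α} (h : ∀ t, f (t + 1) = f t)
    (t : ZMod ℓ) : f t = f 0 := by
  obtain ⟨n, rfl⟩ := ZMod.natCast_zmod_surjective t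
  induction n with
  | zero => simp
  | succ n ih => rw [Nat.cast_succ, h, ih]

open Polynomial in
theorem ZMod.eq_const_of_logDiff_eq_zero {f : ZMod ℓ → ZMod ℓ} (h : ZMod.logDiff ℓ f = 0)
    (t : ZMod ℓ) : f t = f 0 := by
  let T : Module.End (ZMod ℓ) (ZMod ℓ → ZMod ℓ) := LinearMap.funLeft _ _ (· + 1)
  have hT : ∀ (n : ℕ) (f : ZMod ℓ → ZMod ℓ) (t), (T ^ n) f t = f (t + n) := by
    intro n
    induction n with
    | zero => simp
    | succ n ih =>
      intro f t
      rw [pow_succ, Module.End.mul_apply, ih]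
      simp [T, LinearMap.funLeft_apply, add_assoc]
  let E : (ZMod ℓ)[X] := ∑ u : ZMod ℓ, C u⁻¹ * ∑ i ∈ Finset.range u.val, X ^ i
  have hE : (ZMod.logDiff ℓ : Module.End (ZMod ℓ) _) = aeval T (E * (X - C 1)) := by
    have : E * (X - C 1) = ∑ u : ZMod ℓ, C u⁻¹ * (X ^ u.val - 1) := by
      simp_rw [E, Finset.sum_mul, mul_assoc, map_one, geom_sum_mul]
    rw [this]
    ext1 f
    ext t
    simp [ZMod.logDiff_apply, hT, Module.algebraMap_end_apply]
  have hE1 : ¬ (X - C 1) ∣ E := by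
    rw [dvd_iff_isRoot, IsRoot.def]
    have : eval 1 E = ∑ u : ZMod ℓ, (if u = 0 then 0 else 1) := by
      simp only [E, eval_finsetSum, eval_mul, eval_C, eval_pow, eval_X, one_pow,
        Finset.sum_const, Finset.card_range, nsmul_eq_mul, mul_one, ZMod.natCast_val,
        ZMod.cast_id', id]
      refine Finset.sum_congr rfl fun u _ => ?_
      split_ifs with hu
      · simp [hu]
      · exact inv_mul_cancel₀ hu
    rw [this, Finset.sum_ite]
    simp [Finset.filter_ne', Finset.card_erase_of_mem, ZMod.card,
      Nat.cast_sub (Fact.out : ℓ.Prime).one_le]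
  have hco : IsCoprime ((X - C 1) ^ ℓ) E :=
    (((irreducible_X_sub_C (1 : ZMod ℓ)).coprime_iff_not_dvd).2 hE1).pow_left
  have hN : aeval T ((X - C 1 : (ZMod ℓ)[X]) ^ ℓ) = 0 := by
    rw [sub_pow_char, ← map_pow, one_pow]
    ext1 f
    ext t
    simp [hT]
  obtain ⟨a, b, hab⟩ := hco
  have key : aeval T (X - C 1 : (ZMod ℓ)[X]) f = 0 := by
    have h1 : aeval T ((X - C 1) * (a * (X - C 1) ^ ℓ + b * E)) f = 0 := by
      have : (X - C 1) * (a * (X - C 1) ^ ℓ + b * E) =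
        (X - C 1) * a * (X - C 1) ^ ℓ + b * (E * (X - C 1)) := by ring
      rw [this, map_add, map_mul, hN, map_mul _ b, ← hE]
      simp [h]
    rwa [hab, mul_one] at h1
  refine ZMod.eq_const_of_add_one (fun t => ?_) t
  have := congrFun key t
  simpa [T, LinearMap.funLeft_apply, sub_eq_zero] using this

theorem ZMod.logDiff_const (a : ZMod ℓ) : ZMod.logDiff ℓ (fun _ => a) = 0 := by
  ext t; simp [ZMod.logDiff_apply]

theorem ZMod.sumAll_logDiff (f : ZMod ℓ → ZMod ℓ) : ZMod.sumAll ℓ (ZMod.logDiff ℓ f) = 0 := by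
  simp only [ZMod.sumAll_apply, ZMod.logDiff_apply]
  rw [Finset.sum_comm]
  refine Finset.sum_eq_zero fun u _ => ?_
  rw [← Finset.mul_sum, Finset.sum_sub_distrib,
    Fintype.sum_equiv (Equiv.addRight u) (fun t => f (t + u)) f fun _ => rfl, sub_self, mul_zero]

theorem ZMod.sumAll_surjective : Function.Surjective (ZMod.sumAll ℓ) := fun x =>
  ⟨Pi.single 0 x, by simp [ZMod.sumAll_apply]⟩

theorem ZMod.exact_logDiff_sumAll : Function.Exact (ZMod.logDiff ℓ) (ZMod.sumAll ℓ) := by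
  rw [LinearMap.exact_iff]
  symm
  apply Submodule.eq_of_le_of_finrank_le
  · rintro _ ⟨f, rfl⟩
    exact ZMod.sumAll_logDiff f
  · have h₁ := LinearMap.finrank_range_add_finrank_ker (ZMod.logDiff ℓ)
    have h₂ := LinearMap.finrank_range_add_finrank_ker (ZMod.sumAll ℓ)
    rw [LinearMap.range_eq_top.2 ZMod.sumAll_surjective, finrank_top, Module.finrank_self] at h₂
    have h₃ : Module.finrank (ZMod ℓ) (LinearMap.ker (ZMod.logDiff ℓ)) ≤ 1 := by
      refine finrank_le_one ⟨fun _ => 1, ZMod.logDiff_const 1⟩ fun ⟨f, hf⟩ => ⟨f 0, ?_⟩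
      ext t
      simp [ZMod.eq_const_of_logDiff_eq_zero hf t]
    lia

end Difference

section Affine

variable {G : Type} [Group G] {ℓ : ℕ}

/-- `ZMod ℓ` with `G` acting through the character `ψ`. -/
def ZMod.charRep (ψ : G →* (ZMod ℓ)ˣ) : Rep ℤ G :=
  Rep.of (X := ZMod ℓ)
    { toFun := fun g => (AddMonoidHom.mulLeft (ψ g : ZMod ℓ)).toIntLinearMap
      map_one' := by ext; simp
      map_mul' := fun g h => by ext; simp [mul_assoc] }

/-- An action of `G` on `ZMod ℓ` by the affine maps `t ↦ χ g * t + c g`. -/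
structure ZMod.AffineAction (G : Type) [Group G] (ℓ : ℕ) where
  χ : G →* (ZMod ℓ)ˣ
  c : G → ZMod ℓ
  map_mul : ∀ g h, c (g * h) = c g + χ g * c h

namespace ZMod.AffineAction
variable (α : ZMod.AffineAction G ℓ)

theorem map_one : α.c 1 = 0 := by
  simpa using α.map_mul 1 1

theorem map_inv_eq_iff (g : G) (t : ZMod ℓ) : α.χ g * t + α.c g = 0 ↔ α.c g⁻¹ = t := by
  have h := α.map_mul g g⁻¹
  rw [mul_inv_cancel, map_one] at h
  rw [← (α.χ g).isUnit.mul_right_inj (b := α.c g⁻¹)]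
  constructor <;> intro h' <;> linear_combination -h' - h

/-- Functions on the affine line, with `G` acting by translation, twisted by `ψ`. -/
def funRep (ψ : G →* (ZMod ℓ)ˣ) : Rep ℤ G :=
  Rep.of (X := ZMod ℓ → ZMod ℓ)
    { toFun := fun g =>
        { toFun := fun f t => ψ g * f (α.χ g⁻¹ * t + α.c g⁻¹)
          map_add' := fun f f' => by ext; simp [mul_add]
          map_smul' := fun a f => by ext; simp; ring }
      map_one' := by ext; simp [map_one]
      map_mul' := fun g h => by
        ext f t
        simp only [LinearMap.coe_mk, AddHom.coe_mk, Module.End.mul_apply, _root_.map_mul,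
          Units.val_mul, mul_inv_rev, α.map_mul]
        ring_nf }

theorem funRep_ρ_apply (ψ : G →* (ZMod ℓ)ˣ) (g : G) (f : ZMod ℓ → ZMod ℓ) (t : ZMod ℓ) :
    (α.funRep ψ).ρ g f t = ψ g * f (α.χ g⁻¹ * t + α.c g⁻¹) := rfl

/-- The inclusion of the constant functions. -/
def const (ψ : G →* (ZMod ℓ)ˣ) : ZMod.charRep ψ ⟶ α.funRep ψ :=
  Rep.ofHom
    { toFun := fun x _ => x
      map_add' := fun _ _ => rfl
      map_smul' := fun _ _ => rfl
      isIntertwining' := fun _ => rfl }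

variable [Fact ℓ.Prime]

/-- `ZMod.logDiff` as a map of representations; it twists by the inverse of the linear part. -/
noncomputable def diff (ψ : G →* (ZMod ℓ)ˣ) : α.funRep ψ ⟶ α.funRep (ψ * α.χ⁻¹) :=
  Rep.ofHom
    { toLinearMap := (ZMod.logDiff ℓ).toAddMonoidHom.toIntLinearMap
      isIntertwining' := fun g => by
        refine LinearMap.ext fun f => funext fun t => ?_
        change ZMod.logDiff ℓ (fun t => ψ g * f (α.χ g⁻¹ * t + α.c g⁻¹)) t =
          (ψ * α.χ⁻¹) g * ZMod.logDiff ℓ f (α.χ g⁻¹ * t + α.c g⁻¹)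
        simp only [ZMod.logDiff_apply, Finset.mul_sum]
        refine Fintype.sum_equiv (Units.mulLeft (α.χ g⁻¹)) _ _ fun u => ?_
        simp only [Units.mulLeft_apply, MonoidHom.mul_apply, MonoidHom.inv_apply, Units.val_mul,
          _root_.map_inv, mul_inv]
        rw [show ∀ x y : ZMod ℓ, x * (t + u) + y = x * t + y + x * u by intros; ring]
        have := (α.χ g).ne_zero
        simp only [Units.val_inv_eq_inv_val]
        field_simp }

/-- `ZMod.sumAll` as a map of representations. -/
noncomputable def sum (ψ : G →* (ZMod ℓ)ˣ) : α.funRep ψ ⟶ ZMod.charRep ψ :=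
  Rep.ofHom
    { toLinearMap := (ZMod.sumAll ℓ).toAddMonoidHom.toIntLinearMap
      isIntertwining' := fun g => by
        refine LinearMap.ext fun f => ?_
        change ZMod.sumAll ℓ (fun t => ψ g * f (α.χ g⁻¹ * t + α.c g⁻¹)) = ψ g * ZMod.sumAll ℓ f
        simp only [ZMod.sumAll_apply, Finset.mul_sum]
        exact Fintype.sum_equiv ((Units.mulLeft (α.χ g⁻¹)).trans (Equiv.addRight (α.c g⁻¹))) _ _
          fun u => rfl }

variable {α} {τ : G}

theorem eq_const_of_mem_invariants (hχ : α.χ τ = 1) (hc : α.c τ = 1)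
    {ψ : G →* (ZMod ℓ)ˣ} (hψ : ψ τ = 1) (f : ZMod ℓ → ZMod ℓ)
    (hf : f ∈ (α.funRep ψ).ρ.invariants) : f = fun _ => f 0 := by
  ext t
  refine ZMod.eq_const_of_add_one (fun t => ?_) t
  have := congrFun (hf τ⁻¹) t
  rw [funRep_ρ_apply] at this
  simpa [hχ, hc, hψ] using this

theorem card_fiber (hχ : α.χ τ = 1) (hc : α.c τ = 1) [Fintype G] (t : ZMod ℓ) :
    ℓ * (Finset.univ.filter fun g => α.c g⁻¹ = t).card = Fintype.card G := by
  have h : ∀ t, (Finset.univ.filter fun g => α.c g⁻¹ = t).card =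
      (Finset.univ.filter fun g => α.c g⁻¹ = 0).card := by
    refine ZMod.eq_const_of_add_one fun t => ?_
    refine (Finset.card_equiv (Equiv.mulRight τ⁻¹) fun g => ?_).symm
    simp [α.map_mul, hχ, hc, add_comm (1 : ZMod ℓ)]
  rw [← Finset.card_univ, Finset.card_eq_sum_card_fiberwise (f := fun g => α.c g⁻¹)
    (s := Finset.univ) (t := Finset.univ) fun _ _ => Finset.mem_coe.2 (Finset.mem_univ _),
    Finset.sum_congr rfl fun t _ => h t, h t]
  simp [ZMod.card]

theorem isZero_funRep (hχ : α.χ τ = 1) (hc : α.c τ = 1)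
    [Finite G] (hℓ : ¬ ℓ ^ 2 ∣ Nat.card G) (ψ : G →* (ZMod ℓ)ˣ) (n : ℕ) :
    Limits.IsZero (groupCohomology (α.funRep ψ) (n + 1)) := by
  have := Fintype.ofFinite G
  let N (t) := (Finset.univ.filter fun g => α.c g⁻¹ = t).card
  have hN (t) : (N t : ZMod ℓ) ≠ 0 := by
    rw [Ne, ZMod.natCast_eq_zero_iff]
    rintro ⟨r, hr⟩
    apply hℓ
    rw [Nat.card_eq_fintype_card, ← card_fiber hχ hc t]
    exact ⟨r, by change ℓ * N t = _; rw [hr]; ring⟩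
  let e : (ZMod ℓ → ZMod ℓ) →ₗ[ℤ] (ZMod ℓ → ZMod ℓ) :=
    { toFun := fun f => Pi.single 0 ((N 0 : ZMod ℓ)⁻¹ * f 0)
      map_add' := fun f f' => by simp [mul_add, Pi.single_add]
      map_smul' := fun a f => by
        rw [Pi.smul_apply, mul_smul_comm, Pi.single_smul]; rfl }
  rw [Limits.IsZero.iff_id_eq_zero, ← map_id]
  refine map_succ_eq_zero_of_trace (A := α.funRep ψ) e (𝟙 _) (fun f => ?_) n
  change f = _
  refine funext fun t => ?_
  have h (g : G) : (α.funRep ψ).ρ g⁻¹ (e ((α.funRep ψ).ρ g f)) t =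
      if α.c g⁻¹ = t then (N t : ZMod ℓ)⁻¹ * f t else 0 := by
    have hN0 : N 0 = N t := Nat.eq_of_mul_eq_mul_left (Fact.out : ℓ.Prime).pos
      ((card_fiber hχ hc 0).trans (card_fiber hχ hc t).symm)
    change ψ g⁻¹ * (Pi.single 0 ((N 0 : ZMod ℓ)⁻¹ * (ψ g * f (α.χ g⁻¹ * 0 + α.c g⁻¹))) :
      ZMod ℓ → ZMod ℓ) (α.χ g⁻¹⁻¹ * t + α.c g⁻¹⁻¹) = _
    rw [inv_inv, Pi.single_apply, hN0]
    simp only [α.map_inv_eq_iff]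
    split_ifs with hg
    · rw [hg, mul_zero, zero_add, _root_.map_inv, mul_left_comm, Units.inv_mul_cancel_left]
    · rw [mul_zero]
  refine Eq.trans ?_ (Finset.sum_apply t Finset.univ
    fun g => ((α.funRep ψ).ρ g⁻¹ (e ((α.funRep ψ).ρ g f)) : ZMod ℓ → ZMod ℓ)).symm
  rw [Finset.sum_congr rfl fun g _ => h g, ← Finset.sum_filter, Finset.sum_const,
    nsmul_eq_mul, mul_inv_cancel_left₀ (hN t)]

/-- The four-term sequence `const`, `diff`, `sum` shifts degrees by two at the cost of a twist. -/
theorem charRep_dimension_shift (hχ : α.χ τ = 1) (hc : α.c τ = 1)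
    [Finite G] (hℓ : ¬ ℓ ^ 2 ∣ Nat.card G) {ψ : G →* (ZMod ℓ)ˣ}
    (hψ : ψ τ = 1) :
    Nonempty (groupCohomology (ZMod.charRep ψ) 1 ≃ₗ[ℤ]
      groupCohomology (ZMod.charRep (ψ * α.χ⁻¹)) 0) ∧
    ∀ n, Nonempty (groupCohomology (ZMod.charRep ψ) (n + 2) ≃ₗ[ℤ]
      groupCohomology (ZMod.charRep (ψ * α.χ⁻¹)) n) := by
  have key {ψ : G →* (ZMod ℓ)ˣ} (hψ : ψ τ = 1) :=
    nonempty_equiv_of_exact (α.const ψ) (α.diff ψ) (α.sum (ψ * α.χ⁻¹))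
    (fun x y h => congrFun h 0)
    (fun f => ⟨fun h => ⟨f 0, funext fun t => (ZMod.eq_const_of_logDiff_eq_zero h t).symm⟩,
      fun ⟨x, hx⟩ => hx ▸ ZMod.logDiff_const x⟩)
    ZMod.exact_logDiff_sumAll ZMod.sumAll_surjective
    (isZero_funRep hχ hc hℓ _) (isZero_funRep hχ hc hℓ _)
    (map_zero_eq_zero _ fun f hf => by
      rw [eq_const_of_mem_invariants hχ hc hψ f hf]
      exact ZMod.logDiff_const _)
    (map_zero_eq_zero _ fun f hf => by
      rw [eq_const_of_mem_invariants hχ hc (by simp [hψ, hχ]) f hf]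
      change ZMod.sumAll ℓ _ = 0
      simp [ZMod.sumAll_apply])
  obtain ⟨-, h₁, h₂⟩ := key hψ
  obtain ⟨h₀, -, -⟩ := key (ψ := ψ * α.χ⁻¹) (by simp [hψ, hχ])
  exact ⟨h₁.elim fun e => h₀.map fun e' => e ≪≫ₗ e'.symm, h₂⟩

end ZMod.AffineAction

end Affine

section Bockstein

variable {G : Type} [Group G]

theorem groupCohomology.subsingleton_one_trivial_int [Finite G] :
    Subsingleton (groupCohomology (Rep.trivial ℤ G ℤ) 1) := by
  have : Subsingleton (Additive G →+ ℤ) := by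
    refine subsingleton_of_forall_eq 0 fun f => ?_
    ext g
    have hG : Nat.card G ≠ 0 := Nat.card_pos.ne'
    have := congrArg f (show Nat.card G • Additive.ofMul g = 0 from pow_card_eq_one' (x := g))
    simpa [hG] using this
  exact (H1IsoOfIsTrivial (Rep.trivial ℤ G ℤ)).toLinearEquiv.toEquiv.subsingleton

variable (ℓ : ℕ) [Fact ℓ.Prime]

theorem ZMod.subsingleton_charRep {ψ : G →* (ZMod ℓ)ˣ} (hψ : ψ ≠ 1) :
    Subsingleton (groupCohomology (ZMod.charRep ψ) 0) := by
  obtain ⟨g, hg⟩ := DFunLike.exists_ne hψ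
  have : Subsingleton (ZMod.charRep ψ).ρ.invariants := by
    refine subsingleton_of_forall_eq 0 fun x => Subtype.ext ?_
    obtain ⟨(x : ZMod ℓ), hx⟩ := x
    have h : (ψ g : ZMod ℓ) * x = x := hx g
    have h' : ((ψ g : ZMod ℓ) - 1) * x = 0 := by rw [sub_mul, h, one_mul, sub_self]
    exact (mul_eq_zero.1 h').resolve_left fun h => hg (Units.ext (sub_eq_zero.1 h))
  exact (H0Iso (ZMod.charRep ψ)).toLinearEquiv.toEquiv.subsingleton

instance ZMod.isTrivial_charRep_one : (ZMod.charRep (1 : G →* (ZMod ℓ)ˣ)).ρ.IsTrivial where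
  out g := by
    ext x
    exact one_mul (M := ZMod ℓ) x

theorem ZMod.nonempty_equiv_charRep_one :
    Nonempty (groupCohomology (ZMod.charRep (1 : G →* (ZMod ℓ)ˣ)) 0 ≃ₗ[ℤ] ZMod ℓ) :=
  ⟨(H0IsoOfIsTrivial (ZMod.charRep (1 : G →* (ZMod ℓ)ˣ))).toLinearEquiv⟩

instance ZMod.finite_charRep (ψ : G →* (ZMod ℓ)ˣ) :
    Finite (groupCohomology (ZMod.charRep ψ) 0) := by
  have : Finite (ZMod.charRep ψ).ρ.invariants := by
    have : Finite (ZMod.charRep ψ).V := inferInstanceAs (Finite (ZMod ℓ))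
    infer_instance
  exact .of_equiv _ (H0Iso (ZMod.charRep ψ)).toLinearEquiv.toEquiv.symm

/-- Reduction modulo `ℓ`. -/
def ZMod.reduction : Rep.trivial ℤ G ℤ ⟶ ZMod.charRep (1 : G →* (ZMod ℓ)ˣ) :=
  Rep.ofHom
    { toLinearMap := (Int.castAddHom (ZMod ℓ)).toIntLinearMap
      isIntertwining' := fun g => by
        ext
        simp }

/-- The sequence `ℤ ⟶ ℤ ⟶ ZMod ℓ` of trivial representations. -/
def ZMod.bockstein (G : Type) [Group G] : ShortComplex (Rep ℤ G) :=
  ShortComplex.mk (ℓ • 𝟙 (Rep.trivial ℤ G ℤ)) (ZMod.reduction ℓ) (by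
    apply Rep.hom_ext
    ext
    change ((ℓ • (1 : ℤ) : ℤ) : ZMod ℓ) = 0
    simp)

theorem ZMod.bockstein_shortExact : (ZMod.bockstein ℓ G).ShortExact := by
  refine Rep.shortExact_of_exact ?_ ?_ ?_
  · intro x y h
    have h : ℓ • (x : ℤ) = ℓ • (y : ℤ) := h
    exact nsmul_right_injective (M := ℤ) (Fact.out : ℓ.Prime).ne_zero h
  · exact ZMod.intCast_surjective
  · intro y hy
    obtain ⟨x, hx⟩ := (ZMod.intCast_zmod_eq_zero_iff_dvd y ℓ).1 hy
    exact ⟨x, (nsmul_eq_mul ℓ (x : ℤ)).trans hx.symm⟩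

/-- The long exact sequence of `ZMod.bockstein`, with multiplication by `ℓ` made explicit. -/
theorem ZMod.bockstein_exact (G : Type) [Group G] :
    ∃ (r : ∀ n, groupCohomology (Rep.trivial ℤ G ℤ) n →+
        groupCohomology (ZMod.charRep (1 : G →* (ZMod ℓ)ˣ)) n)
      (d : ∀ n, groupCohomology (ZMod.charRep (1 : G →* (ZMod ℓ)ˣ)) n →+
        groupCohomology (Rep.trivial ℤ G ℤ) (n + 1)),
      (∀ n x, r n x = 0 ↔ ∃ y, ℓ • y = x) ∧ (∀ n x, d n x = 0 ↔ ∃ y, r n y = x) ∧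
        ∀ n x, ℓ • x = 0 ↔ ∃ y, d n y = x := by
  have hX := ZMod.bockstein_shortExact (G := G) ℓ
  refine ⟨fun n => (map (.id G) (ZMod.bockstein ℓ G).g n).hom.toAddMonoidHom,
    fun n => (δ hX n (n + 1) rfl).hom.toAddMonoidHom, fun n x => ?_, exact_map_δ hX, fun n x => ?_⟩
  · exact (exact_map_map hX n x).trans
      (exists_congr fun y => Eq.congr_left (map_nsmul_id (Rep.trivial ℤ G ℤ) ℓ n y))
  · exact (Eq.congr_left (map_nsmul_id (Rep.trivial ℤ G ℤ) ℓ (n + 1) x)).symm.trans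
      (exact_δ_map hX n x)

end Bockstein

section Torsion

theorem Nat.Coprime.exists_eq_nsmul_add {M : Type*} [AddCommGroup M] {ℓ m : ℕ} (h : ℓ.Coprime m)
    {x : M} (hx : (ℓ * m) • x = 0) :
    ∃ y z, x = ℓ • y + z ∧ m • ℓ • y = 0 ∧ ℓ • z = 0 := by
  have h1 : (ℓ : ℤ) * ℓ.gcdA m + m * ℓ.gcdB m = 1 := by
    rw [← Nat.gcd_eq_gcd_ab, h, Nat.cast_one]
  refine ⟨ℓ.gcdA m • x, m • ℓ.gcdB m • x, ?_, ?_, ?_⟩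
  · simp only [← natCast_zsmul, smul_smul, ← add_smul, h1, one_smul]
  · rw [← mul_nsmul, smul_comm, hx, smul_zero]
  · rw [← mul_nsmul', smul_comm, hx, smul_zero]

theorem Nat.Coprime.eq_zero_of_nsmul_eq_zero {M : Type*} [AddCommGroup M] {ℓ m : ℕ}
    (h : ℓ.Coprime m) {x : M} (hℓ : ℓ • x = 0) (hm : m • x = 0) : x = 0 := by
  have h1 : addOrderOf x ∣ 1 := h ▸
    Nat.dvd_gcd (addOrderOf_dvd_of_nsmul_eq_zero hℓ) (addOrderOf_dvd_of_nsmul_eq_zero hm)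
  simpa using h1

/-- In a Bockstein long exact sequence whose mod `ℓ` terms have equal finite cardinality in degrees
`2 * k + 1` and `2 * k + 2`, the `ℓ`-torsion vanishes in odd degrees and in degree
`2 * k + 2` is the mod `ℓ` term of degree `2 * k + 1`. -/
theorem bockstein_torsion {ℓ m : ℕ} (hm : ℓ.Coprime m) {H F : ℕ → Type*}
    [∀ n, AddCommGroup (H n)] [∀ n, AddCommGroup (F n)]
    (r : ∀ n, H n →+ F n) (d : ∀ n, F n →+ H (n + 1))
    (hr : ∀ n x, r n x = 0 ↔ ∃ y, ℓ • y = x) (hd : ∀ n x, d n x = 0 ↔ ∃ y, r n y = x)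
    (hℓ : ∀ n x, ℓ • x = 0 ↔ ∃ y, d n y = x)
    (hH : ∀ n (x : H (n + 1)), (ℓ * m) • x = 0) (hH₁ : Subsingleton (H 1))
    (hF : ∀ k, Finite (F (2 * k + 2)) ∧ Nonempty (F (2 * k + 1) ≃ F (2 * k + 2))) (k : ℕ) :
    (∀ x : H (2 * k + 1), ℓ • x = 0 → x = 0) ∧ Function.Injective (d (2 * k + 1)) := by
  have hdiv {n : ℕ} (h : ∀ x : H (n + 1), ℓ • x = 0 → x = 0) :
      Function.Injective (d (n + 1)) := by
    rw [injective_iff_map_eq_zero]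
    intro y hy
    obtain ⟨x, rfl⟩ := (hd _ y).1 hy
    obtain ⟨y, z, rfl, -, hz⟩ := hm.exists_eq_nsmul_add (hH n x)
    rw [h z hz, add_zero]
    exact (hr _ _).2 ⟨y, rfl⟩
  suffices h : ∀ x : H (2 * k + 1), ℓ • x = 0 → x = 0 from ⟨h, hdiv h⟩
  induction k with
  | zero => exact fun x _ => Subsingleton.elim (α := H 1) x 0
  | succ k ih =>
    have hinj : Function.Injective (r (2 * k + 2) ∘ d (2 * k + 1)) := by
      rw [← AddMonoidHom.coe_comp, injective_iff_map_eq_zero]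
      intro y hy
      obtain ⟨x, hx⟩ := (hr _ _).1 hy
      have h₁ : ℓ • d (2 * k + 1) y = 0 := (hℓ _ _).2 ⟨y, rfl⟩
      refine (injective_iff_map_eq_zero _).1 (hdiv ih) y ?_
      refine hm.eq_zero_of_nsmul_eq_zero h₁ ?_
      rw [← hx, ← mul_nsmul, hH]
    obtain ⟨hfin, ⟨e⟩⟩ := hF k
    have hsurj := ((Function.Injective.bijective_of_nat_card_le hinj
      (Nat.card_congr e).ge).surjective).of_comp
    intro x hx
    obtain ⟨y, rfl⟩ := (hℓ _ x).1 hx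
    exact (hd _ y).2 (hsurj y)

/-- A group killed by `p * q` whose `p`- and `q`-torsion are cyclic of order `p` and `q` is
cyclic of order `p * q`. -/
theorem nonempty_equiv_of_torsion {M : Type*} [AddCommGroup M] {p q : ℕ} (h : p.Coprime q)
    (hM : ∀ x : M, (p * q) • x = 0) (f : ZMod p →+ M) (g : ZMod q →+ M)
    (hf : Function.Injective f) (hg : Function.Injective g)
    (hf' : ∀ x, p • x = 0 → ∃ y, f y = x) (hg' : ∀ x, q • x = 0 → ∃ y, g y = x) :
    Nonempty (M ≃+ ZMod (p * q)) := by
  have hbij : Function.Bijective (f.coprod g) := by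
    constructor
    · rw [injective_iff_map_eq_zero]
      rintro ⟨a, b⟩ hab
      have hp : p • f a = 0 := by rw [← map_nsmul]; simp
      have hq : q • g b = 0 := by rw [← map_nsmul]; simp
      have hab : f a = - g b := eq_neg_of_add_eq_zero_left hab
      have ha : f a = 0 := h.eq_zero_of_nsmul_eq_zero hp (by rw [hab, smul_neg, hq, neg_zero])
      have hb : g b = 0 := by rw [ha] at hab; exact neg_eq_zero.1 hab.symm
      exact Prod.ext ((injective_iff_map_eq_zero _).1 hf a ha)
        ((injective_iff_map_eq_zero _).1 hg b hb)
    · intro x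
      obtain ⟨y, z, rfl, hy, hz⟩ := h.exists_eq_nsmul_add (hM x)
      obtain ⟨a, ha⟩ := hf' z hz
      obtain ⟨b, hb⟩ := hg' _ hy
      exact ⟨(a, b), by simp [ha, hb, add_comm]⟩
  exact ⟨(AddEquiv.ofBijective _ hbij).symm.trans (ZMod.chineseRemainder h).toAddEquiv.symm⟩

theorem AddEquiv.nonempty_int_linearEquiv {M N : Type*} [AddCommGroup M] [AddCommGroup N]
    [Module ℤ M] [Module ℤ N] (e : M ≃+ N) : Nonempty (M ≃ₗ[ℤ] N) :=
  ⟨{ e with map_smul' := fun c x => by simpa using map_intCast_smul e ℤ ℤ c x }⟩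

end Torsion

section AffineTorsion

variable {G : Type} [Group G] {ℓ : ℕ} [Fact ℓ.Prime]

namespace ZMod.AffineAction
variable {α : ZMod.AffineAction G ℓ} {τ : G}

theorem nonempty_equiv_charRep (hχ : α.χ τ = 1) (hc : α.c τ = 1)
    [Finite G] (hℓ : ¬ ℓ ^ 2 ∣ Nat.card G) {ψ : G →* (ZMod ℓ)ˣ}
    (hψ : ψ τ = 1) (n k : ℕ) :
    Nonempty (groupCohomology (ZMod.charRep ψ) (n + 2 * k) ≃ₗ[ℤ]
      groupCohomology (ZMod.charRep (ψ * (α.χ ^ k)⁻¹)) n) := by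
  induction k generalizing ψ with
  | zero =>
    rw [show ψ * (α.χ ^ 0)⁻¹ = ψ by ext; simp]
    exact ⟨.refl _ _⟩
  | succ k ih =>
    obtain ⟨e⟩ := (charRep_dimension_shift hχ hc hℓ hψ).2 (n + 2 * k)
    obtain ⟨e'⟩ := ih (ψ := ψ * α.χ⁻¹) (by simp [hψ, hχ])
    have hψ' : ψ * (α.χ ^ (k + 1))⁻¹ = ψ * α.χ⁻¹ * (α.χ ^ k)⁻¹ :=
      MonoidHom.ext fun g => by
        change ψ g * (α.χ g ^ (k + 1))⁻¹ = ψ g * (α.χ g)⁻¹ * (α.χ g ^ k)⁻¹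
        rw [pow_succ', mul_inv, mul_assoc]
    rw [hψ']
    exact ⟨e ≪≫ₗ e'⟩

/-- The `ℓ`-torsion of integral cohomology vanishes in odd degrees, and in degree `2 * k + 2` it is
`ZMod ℓ` or zero, according to whether the `k + 1`-st power of the linear part is trivial. -/
theorem torsion (hχ : α.χ τ = 1) (hc : α.c τ = 1)
    [Finite G] {m : ℕ} (hm : ℓ.Coprime m) (hG : Nat.card G = ℓ * m) (k : ℕ) :
    (∀ x : groupCohomology (Rep.trivial ℤ G ℤ) (2 * k + 1), ℓ • x = 0 → x = 0) ∧
    (α.χ ^ (k + 1) ≠ 1 →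
      ∀ x : groupCohomology (Rep.trivial ℤ G ℤ) (2 * k + 2), ℓ • x = 0 → x = 0) ∧
    (α.χ ^ (k + 1) = 1 → ∃ f : ZMod ℓ →+ groupCohomology (Rep.trivial ℤ G ℤ) (2 * k + 2),
      Function.Injective f ∧ ∀ x, ℓ • x = 0 → ∃ y, f y = x) := by
  have hℓ : ¬ ℓ ^ 2 ∣ Nat.card G := by
    rw [hG, sq, Nat.mul_dvd_mul_iff_left (Fact.out : ℓ.Prime).pos]
    exact (Nat.Prime.coprime_iff_not_dvd Fact.out).1 hm
  have hodd (k : ℕ) : Nonempty (groupCohomology (ZMod.charRep (1 : G →* (ZMod ℓ)ˣ)) (2 * k + 1) ≃+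
      groupCohomology (ZMod.charRep (α.χ ^ (k + 1))⁻¹) 0) := by
    obtain ⟨e⟩ := nonempty_equiv_charRep hχ hc hℓ (ψ := 1) (by simp) 1 k
    obtain ⟨e'⟩ := (charRep_dimension_shift hχ hc hℓ (ψ := (α.χ ^ k)⁻¹) (by simp [hχ])).1
    rw [show 1 * (α.χ ^ k)⁻¹ = (α.χ ^ k)⁻¹ by ext; simp, add_comm] at e
    have hk : (α.χ ^ (k + 1))⁻¹ = (α.χ ^ k)⁻¹ * α.χ⁻¹ :=
      MonoidHom.ext fun g => by
        change (α.χ g ^ (k + 1))⁻¹ = (α.χ g ^ k)⁻¹ * (α.χ g)⁻¹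
        rw [pow_succ, mul_inv]
    rw [hk]
    exact ⟨(e ≪≫ₗ e').toAddEquiv⟩
  obtain ⟨r, d, hr, hd, hℓ'⟩ := ZMod.bockstein_exact ℓ G
  obtain ⟨h, hinj⟩ := bockstein_torsion hm r d hr hd hℓ'
    (fun n x => by rw [← hG]; exact card_nsmul_eq_zero _ n x) subsingleton_one_trivial_int
    (fun k => by
      obtain ⟨e⟩ := nonempty_equiv_charRep hχ hc hℓ (ψ := 1) (by simp) 0 (k + 1)
      rw [show 1 * (α.χ ^ (k + 1))⁻¹ = (α.χ ^ (k + 1))⁻¹ by ext; simp, zero_add] at e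
      obtain ⟨e'⟩ := hodd k
      exact ⟨.of_equiv _ e.symm.toEquiv, ⟨e'.toEquiv.trans e.symm.toEquiv⟩⟩) k
  obtain ⟨e⟩ := hodd k
  refine ⟨h, fun hψ x hx => ?_, fun hψ => ?_⟩
  · have hψ' : (α.χ ^ (k + 1))⁻¹ ≠ 1 := fun h => hψ <| MonoidHom.ext fun g =>
      inv_eq_one.1 (DFunLike.congr_fun h g)
    have := ZMod.subsingleton_charRep ℓ hψ'
    obtain ⟨y, rfl⟩ := (hℓ' _ x).1 hx
    rw [e.injective (Subsingleton.elim (e y) (e 0)), map_zero]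
  · obtain ⟨e'⟩ := ZMod.nonempty_equiv_charRep_one (G := G) ℓ
    rw [hψ, show (1 : G →* (ZMod ℓ)ˣ)⁻¹ = 1 by ext; simp] at e
    let e'' := e'.toAddEquiv.symm.trans e.symm
    refine ⟨(d (2 * k + 1)).comp e''.toAddMonoidHom, hinj.comp e''.injective, fun x hx => ?_⟩
    obtain ⟨y, rfl⟩ := (hℓ' _ x).1 hx
    exact ⟨e''.symm y, congrArg _ (e''.apply_symm_apply y)⟩

end ZMod.AffineAction

end AffineTorsion

section GroupTheory

variable {G : Type} [Group G] {ℓ : ℕ}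

/-- A surjection onto a group of order `ℓ` is an action by translations. -/
theorem ZMod.exists_affineAction_of_index [Fact ℓ.Prime] (P : Subgroup G) [P.Normal]
    (hP : P.index = ℓ) :
    ∃ (α : ZMod.AffineAction G ℓ) (τ : G), α.χ = 1 ∧ α.c τ = 1 := by
  have hcyc : IsCyclic (G ⧸ P) := isCyclic_of_prime_card (p := ℓ) hP
  subst hP
  let e : Multiplicative (ZMod P.index) ≃* G ⧸ P := zmodCyclicMulEquiv hcyc
  obtain ⟨τ, hτ⟩ := QuotientGroup.mk_surjective (e (.ofAdd 1))
  refine ⟨⟨1, fun g => (e.symm (g : G ⧸ P)).toAdd, fun g h => by simp⟩, τ, rfl, ?_⟩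
  simp [hτ]

/-- Conjugation on a normal subgroup of order `ℓ` is a character. -/
theorem MulAut.exists_zmod_char (P : Subgroup G) [P.Normal] (e : P ≃* Multiplicative (ZMod ℓ)) :
    ∃ χ : G →* (ZMod ℓ)ˣ, ∀ g x, (e (MulAut.conjNormal g x)).toAdd = χ g * (e x).toAdd := by
  let u : AddAut (ZMod ℓ) →+ Additive (ZMod ℓ)ˣ := (ZMod.AddAutEquivUnits ℓ).toAddMonoidHom
  have hu (f : AddAut (ZMod ℓ)) (x : ZMod ℓ) : ((u f).toMul : ZMod ℓ) * x = f x := by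
    change f 1 * x = f x
    rw [mul_comm, ← x.intCast_zmod_cast, ← zsmul_eq_mul, ← map_zsmul, zsmul_one]
  let χ : G →* (ZMod ℓ)ˣ := ((ZMod.AddAutEquivUnits ℓ).toMultiplicative.toMonoidHom.comp
    (MulAutMultiplicative (ZMod ℓ)).toMonoidHom).comp
      ((MulAut.congr e).toMonoidHom.comp MulAut.conjNormal)
  refine ⟨χ, fun g x => ?_⟩
  refine Eq.trans ?_ (hu _ _).symm
  change (e (MulAut.conjNormal g x)).toAdd = (e (MulAut.conjNormal g (e.symm (e x)))).toAdd
  rw [e.symm_apply_apply]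

theorem Subgroup.IsComplement'.exists_retraction {P Q : Subgroup G} [P.Normal]
    (h : Q.IsComplement' P) : ∃ s : G →* G, s.ker = P ∧ ∀ g, g * (s g)⁻¹ ∈ P := by
  refine ⟨Q.subtype.comp (h.QuotientMulEquiv.toMonoidHom.comp (QuotientGroup.mk' P)), ?_, ?_⟩
  · ext g
    change ((h.QuotientMulEquiv (g : G ⧸ P) : Q) : G) = 1 ↔ g ∈ P
    rw [OneMemClass.coe_eq_one, EmbeddingLike.map_eq_one_iff, QuotientGroup.eq_one_iff]
  · intro g
    have : (h.QuotientMulEquiv (g : G ⧸ P) : G ⧸ P) = g := h.QuotientMulEquiv.symm_apply_apply _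
    rw [← div_eq_mul_inv, ← QuotientGroup.eq_iff_div_mem]
    exact this.symm

/-- `G` acts by affine maps on a complemented normal subgroup of order `ℓ`. -/
theorem ZMod.exists_affineAction_of_isComplement {P Q : Subgroup G} [P.Normal]
    (hPQ : Q.IsComplement' P) (e : P ≃* Multiplicative (ZMod ℓ)) :
    ∃ (α : ZMod.AffineAction G ℓ) (τ : G), α.χ τ = 1 ∧ α.c τ = 1 ∧
      α.χ.ker = Subgroup.centralizer P := by
  obtain ⟨s, hs, hsP⟩ := hPQ.exists_retraction
  obtain ⟨χ, hχ⟩ := MulAut.exists_zmod_char P e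
  let α : ZMod.AffineAction G ℓ := ⟨χ, fun g => (e ⟨g * (s g)⁻¹, hsP g⟩).toAdd, fun g h => by
    rw [← hχ, add_comm, ← toAdd_mul, ← map_mul]
    congr 2
    ext
    simp [mul_assoc]⟩
  have hker : χ.ker = Subgroup.centralizer P := by
    ext g
    rw [MonoidHom.mem_ker, Subgroup.mem_centralizer_iff]
    constructor
    · intro hg x hx
      have := hχ g ⟨x, hx⟩
      rw [hg, Units.val_one, one_mul] at this
      have := congrArg Subtype.val (e.injective (Multiplicative.toAdd.injective this))
      rw [MulAut.conjNormal_apply, mul_inv_eq_iff_eq_mul] at this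
      exact this.symm
    · intro hg
      obtain ⟨x, hx⟩ := e.surjective (.ofAdd 1)
      have := hχ g x
      rw [show MulAut.conjNormal g x = x from Subtype.ext (by
        rw [MulAut.conjNormal_apply, ← hg x x.2, mul_inv_cancel_right]), hx] at this
      exact Units.ext (by simpa using this.symm)
  obtain ⟨τ, hτ⟩ := e.surjective (.ofAdd 1)
  refine ⟨α, τ, ?_, ?_, hker⟩
  · change τ.1 ∈ χ.ker
    rw [hker, Subgroup.mem_centralizer_iff]
    intro x hx
    have : (⟨x, hx⟩ : P) * τ = τ * ⟨x, hx⟩ := e.injective (by rw [map_mul, map_mul, mul_comm])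
    exact congrArg Subtype.val this
  · have hsτ : s τ = 1 := by rw [← MonoidHom.mem_ker, hs]; exact τ.2
    change (e ⟨τ * (s τ)⁻¹, hsP τ⟩).toAdd = 1
    simp [hsτ, hτ]

/-- A character of a nonabelian group whose kernel is the centralizer of an abelian normal subgroup
of prime index `q` has order `q`. -/
theorem MonoidHom.orderOf_eq_of_ker_eq_centralizer {q : ℕ} [Fact q.Prime] {P : Subgroup G}
    [P.Normal] [IsMulCommutative P] (hP : P.index = q) (hnab : ¬ ∀ a b : G, a * b = b * a)
    {M : Type*} [CommGroup M] (χ : G →* M) (hχ : χ.ker = Subgroup.centralizer P) :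
    orderOf χ = q := by
  have hle : P ≤ χ.ker := hχ ▸ P.le_centralizer
  apply orderOf_eq_prime
  · ext g
    rw [MonoidHom.pow_apply, ← map_pow]
    exact hle (hP ▸ P.pow_index_mem g)
  · rintro rfl
    rw [MonoidHom.ker_one, eq_comm, Subgroup.centralizer_eq_top_iff_subset] at hχ
    have : IsCyclic (G ⧸ P) := isCyclic_of_prime_card (p := q) hP
    exact hnab ((QuotientGroup.mk' P).isMulCommutative_of_isCyclic_of_ker_le_center
      (by rwa [QuotientGroup.ker_mk'])).is_comm.comm

end GroupTheory

/-- Let `p` and `q` be distinct primes and `G` a nonabelian group of order `p * q` with a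
normal subgroup `P` of order `p`.  Then the integral group cohomology of `G` with trivial
coefficients `ℤ` is: `H^0(G;ℤ) ≅ ℤ`; `H^i(G;ℤ) = 0` for odd `i`; `H^{2k}(G;ℤ) ≅ ℤ/qℤ`
for `k > 0` not divisible by `q`; and `H^{2k}(G;ℤ) ≅ ℤ/pqℤ` for `k > 0` divisible by `q`. -/
theorem groupCohomology_trivial_int_of_nonabelian_pq
    {p q : ℕ} (hp : p.Prime) (hq : q.Prime) (hpq : p ≠ q)
    (G : Type) [Group G] [Finite G]
    (hnab : ¬ ∀ a b : G, a * b = b * a)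
    (hG : Nat.card G = p * q)
    (P : Subgroup G) (hPn : P.Normal) (hP : Nat.card P = p) :
    Nonempty (groupCohomology (Rep.trivial ℤ G ℤ) 0 ≃ₗ[ℤ] ℤ) ∧
    (∀ i : ℕ, Odd i → Subsingleton (groupCohomology (Rep.trivial ℤ G ℤ) i)) ∧
    (∀ k : ℕ, 0 < k → ¬ q ∣ k →
      Nonempty (groupCohomology (Rep.trivial ℤ G ℤ) (2 * k) ≃ₗ[ℤ] ZMod q)) ∧
    (∀ k : ℕ, 0 < k → q ∣ k →
      Nonempty (groupCohomology (Rep.trivial ℤ G ℤ) (2 * k) ≃ₗ[ℤ] ZMod (p * q))) := by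
  have : Fact p.Prime := ⟨hp⟩
  have : Fact q.Prime := ⟨hq⟩
  have hco : p.Coprime q := (Nat.coprime_primes hp hq).2 hpq
  have hPi : P.index = q := by
    rw [← P.card_mul_index, hP] at hG
    exact Nat.eq_of_mul_eq_mul_left hp.pos hG
  have hcyc : IsCyclic P := isCyclic_of_prime_card hP
  have hkill (n : ℕ) (x : groupCohomology (Rep.trivial ℤ G ℤ) (n + 1)) : (p * q) • x = 0 := by
    rw [← hG]; exact card_nsmul_eq_zero _ n x
  obtain ⟨α, τ, hατ, hcτ, hα⟩ : ∃ (α : ZMod.AffineAction G p) (τ : G), α.χ τ = 1 ∧ α.c τ = 1 ∧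
      α.χ.ker = Subgroup.centralizer P := by
    obtain ⟨Q, hQ⟩ := Subgroup.exists_left_complement'_of_coprime (N := P) (by rwa [hP, hPi])
    have e := zmodCyclicMulEquiv hcyc
    rw [hP] at e
    exact ZMod.exists_affineAction_of_isComplement hQ e.symm
  obtain ⟨β, σ, hβ, hcσ⟩ := ZMod.exists_affineAction_of_index P hPi
  have hord := MonoidHom.orderOf_eq_of_ker_eq_centralizer hPi hnab α.χ hα
  have hTp := ZMod.AffineAction.torsion hατ hcτ hco hG
  have hTq := ZMod.AffineAction.torsion (by rw [hβ, MonoidHom.one_apply]) hcσ hco.symm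
    (hG.trans (mul_comm p q))
  have hq_tors (k : ℕ) := (hTq k).2.2 (by rw [hβ]; ext; simp)
  refine ⟨⟨(H0IsoOfIsTrivial (Rep.trivial ℤ G ℤ)).toLinearEquiv⟩, ?_, ?_, ?_⟩
  · rintro i ⟨k, rfl⟩
    refine subsingleton_of_forall_eq 0 fun x => ?_
    refine (hTp k).1 x ((hTq k).1 _ ?_)
    rw [← mul_nsmul, hkill]
  · rintro (_ | k) hk hqk
    · exact absurd hk (lt_irrefl 0)
    obtain ⟨g, hg, hg'⟩ := hq_tors k
    have hχ : α.χ ^ (k + 1) ≠ 1 := fun h => hqk (hord ▸ orderOf_dvd_of_pow_eq_one h)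
    have hsurj : Function.Surjective g := fun x =>
      hg' x ((hTp k).2.1 hχ _ (by rw [← mul_nsmul', hkill]))
    exact (AddEquiv.ofBijective g ⟨hg, hsurj⟩).symm.nonempty_int_linearEquiv
  · rintro (_ | k) hk hqk
    · exact absurd hk (lt_irrefl 0)
    obtain ⟨f, hf, hf'⟩ := (hTp k).2.2 (orderOf_dvd_iff_pow_eq_one.1 (hord.symm ▸ hqk))
    obtain ⟨g, hg, hg'⟩ := hq_tors k
    obtain ⟨e⟩ := nonempty_equiv_of_torsion hco (hkill _) f g hf hg hf' hg'
    exact e.nonempty_int_linearEquiv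
end
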